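/- For 0 ≤ p ≤ n let Ñ_p denote the bounded inverse of □̃_p = ∂*∂ + ∂∂* on A²_{(p,0)}(ℂⁿ, e^{-|z|²}). Then Ñ_{p+1}∂ = ∂Ñ_p on dom(∂) and Ñ_{p−1}∂* = ∂*Ñ_p on dom(∂*); moreover ∂*Ñ_p vanishes on (ker ∂)^⊥, i.e. ∂*Ñ_p k = 0 for every k ∈ A²_{(p,0)}(ℂⁿ, e^{-|z|²}) orthogonal to ker ∂. -/

import Mathlib

open MeasureTheory Filter Complex Finset

noncomputable section

/-- Points of `ℂⁿ`. -/
abbrev Cn (n : ℕ) := Fin n → ℂ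

/-- A form with coefficients indexed by subsets of `{1,…,n}`; a `(p,0)`-form
`Σ'_{|J|=p} u_J dz_J` is such a family supported on sets of cardinality `p`. -/
abbrev FormC (n : ℕ) := Finset (Fin n) → Cn n → ℂ

/-- The Fock weight `e^{-|z|²}` on `ℂⁿ`. -/
def fWt {n : ℕ} (z : Cn n) : ℝ := Real.exp (-(∑ j, ‖z j‖ ^ 2))

/-- Squared Fock norm `‖f‖² = ∫ |f|² e^{-|z|²} dλ`. -/
def fNormSq {n : ℕ} (f : Cn n → ℂ) : ℝ := ∫ z : Cn n, ‖f z‖ ^ 2 * fWt z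

/-- Fock inner product `(f,g) = ∫ f ḡ e^{-|z|²} dλ`. -/
def fInner {n : ℕ} (f g : Cn n → ℂ) : ℂ :=
  ∫ z : Cn n, f z * (starRingEnd ℂ) (g z) * fWt z

/-- Membership in the Fock space `A²(ℂⁿ, e^{-|z|²})`. -/
def MemF {n : ℕ} (f : Cn n → ℂ) : Prop :=
  Differentiable ℂ f ∧ Integrable (fun z : Cn n => ‖f z‖ ^ 2 * fWt z)

/-- The holomorphic partial derivative `∂f/∂z_j`. -/
def pdz {n : ℕ} (j : Fin n) (f : Cn n → ℂ) : Cn n → ℂ :=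
  fun z => fderiv ℂ f z (Pi.single j 1)

/-- The sign `(-1)^{#{i ∈ J : i < j}}` arising from `dz_j ∧ dz_J`. -/
def sgn {n : ℕ} (j : Fin n) (J : Finset (Fin n)) : ℂ :=
  (-1 : ℂ) ^ (J.filter (fun i => i < j)).card

/-- The operator `∂`: `(∂u)_L = Σ_{j ∈ L} ± ∂u_{L\{j}}/∂z_j`, i.e.
`∂u = Σ'_J Σ_j (∂u_J/∂z_j) dz_j ∧ dz_J`. -/
def dOp {n : ℕ} (u : FormC n) : FormC n :=
  fun L z => ∑ j ∈ L, sgn j (L.erase j) * pdz j (u (L.erase j)) z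

/-- The adjoint `∂*`: `(∂*u)_K = Σ_{j ∉ K} ± z_j u_{K ∪ {j}}`, i.e.
`∂*u = Σ'_K Σ_j z_j u_{jK} dz_K` on the Fock space. -/
def dStarOp {n : ℕ} (u : FormC n) : FormC n :=
  fun K z => ∑ j ∈ Kᶜ, sgn j K * (z j * u (insert j K) z)

/-- The complex Laplacian `□̃ = ∂*∂ + ∂∂*`. -/
def boxOp {n : ℕ} (u : FormC n) : FormC n :=
  fun J z => dStarOp (dOp u) J z + dOp (dStarOp u) J z

/-- All coefficients belong to the Fock space. -/
def MemA2 {n : ℕ} (u : FormC n) : Prop := ∀ J, MemF (u J)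

/-- `u` is a `(p,0)`-form: only coefficients with `|J| = p` may be nonzero. -/
def IsDeg {n : ℕ} (p : ℕ) (u : FormC n) : Prop :=
  ∀ J : Finset (Fin n), J.card ≠ p → u J = 0

/-- Squared norm of a form: `Σ'_J ‖u_J‖²`. -/
def formNormSq {n : ℕ} (u : FormC n) : ℝ := ∑ J : Finset (Fin n), fNormSq (u J)

/-- Inner product of forms: `Σ'_J (u_J, v_J)`. -/
def formInner {n : ℕ} (u v : FormC n) : ℂ := ∑ J : Finset (Fin n), fInner (u J) (v J)

/-- `u ∈ dom ∂`. -/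
def domD {n : ℕ} (u : FormC n) : Prop := MemA2 u ∧ MemA2 (dOp u)

/-- `u ∈ dom ∂*`. -/
def domDs {n : ℕ} (u : FormC n) : Prop := MemA2 u ∧ MemA2 (dStarOp u)

/-- `u ∈ dom □̃`: `u ∈ dom ∂ ∩ dom ∂*`, `∂u ∈ dom ∂*` and `∂*u ∈ dom ∂`. -/
def domBox {n : ℕ} (u : FormC n) : Prop :=
  domD u ∧ domDs u ∧ domDs (dOp u) ∧ domD (dStarOp u)

/-- `N` is the bounded inverse `Ñ_p` of `□̃_p` on `A²_{(p,0)}(ℂⁿ, e^{-|z|²})`: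
for `v ∈ A²_{(p,0)}`, `N v` is the unique element of `dom □̃_p` with
`□̃_p (N v) = v`. -/
def IsInvBox {n : ℕ} (p : ℕ) (N : FormC n → FormC n) : Prop :=
  ∀ v : FormC n, IsDeg p v → MemA2 v →
    (IsDeg p (N v) ∧ domBox (N v) ∧ boxOp (N v) = v) ∧
    (∀ u : FormC n, IsDeg p u → domBox u → boxOp u = v → N v = u)


lemma conj_sgn {n : ℕ} (j : Fin n) (J : Finset (Fin n)) :
    (starRingEnd ℂ) (sgn j J) = sgn j J := by
  simp [sgn]

lemma sgn_insert {n : ℕ} {j l : Fin n} {K : Finset (Fin n)} (hj : j ∉ K) :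
    sgn l (insert j K) = (if j < l then -1 else 1) * sgn l K := by
  unfold sgn
  rw [Finset.filter_insert]
  split_ifs with h
  · rw [Finset.card_insert_of_notMem (by simp [hj]), pow_succ]; ring
  · simp

/-- Adding two indices in either order produces opposite signs. -/
lemma sgn_mul_sgn_insert {n : ℕ} {j l : Fin n} {K : Finset (Fin n)} (hj : j ∉ K) (hl : l ∉ K)
    (hjl : j ≠ l) :
    sgn j K * sgn l (insert j K) = -(sgn l K * sgn j (insert l K)) := by
  rw [sgn_insert hj, sgn_insert hl]
  rcases lt_or_gt_of_ne hjl with h | h <;> simp [h, h.not_gt] <;> ring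

lemma sum_sum_eq_zero_of_antisymm {ι : Type*} [Fintype ι] (a : ι → ι → ℂ)
    (h : ∀ i j, a i j = -a j i) : ∑ i, ∑ j, a i j = 0 := by
  have h1 : ∑ i, ∑ j, a i j = -∑ i, ∑ j, a i j := by
    conv_lhs => rw [Finset.sum_comm]
    simp only [← Finset.sum_neg_distrib]
    exact Finset.sum_congr rfl fun i _ => Finset.sum_congr rfl fun j _ => h j i
  exact self_eq_neg.mp h1

/-- `∂* ∘ ∂* = 0`. -/
lemma dStarOp_dStarOp {n : ℕ} (u : FormC n) : dStarOp (dStarOp u) = 0 := by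
  funext K z
  have key : dStarOp (dStarOp u) K z = ∑ j, ∑ l, (if j ∉ K ∧ l ∉ K ∧ l ≠ j then
      sgn j K * sgn l (insert j K) * (z j * z l * u (insert l (insert j K)) z) else 0) := by
    simp only [dStarOp]
    rw [← Finset.sum_filter_add_sum_filter_not univ (fun j => j ∉ K)]
    rw [Finset.sum_eq_zero (s := univ.filter fun j => ¬ j ∉ K), add_zero]
    · refine Finset.sum_congr (by ext; simp) fun j hj => ?_
      have hj' : j ∉ K := by simpa using hj
      rw [← Finset.sum_filter, Finset.mul_sum, Finset.mul_sum]
      refine Finset.sum_congr (by ext; simp [hj', and_comm]) fun l _ => by ring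
    · intro j hj
      have : j ∈ K := by simpa using hj
      simp [this]
  rw [key]
  refine sum_sum_eq_zero_of_antisymm _ fun j l => ?_
  by_cases h : j ∉ K ∧ l ∉ K ∧ l ≠ j
  · rw [if_pos h, if_pos ⟨h.2.1, h.1, h.2.2.symm⟩, sgn_mul_sgn_insert h.1 h.2.1 h.2.2.symm,
      Finset.insert_comm]
    ring
  · rw [if_neg h, if_neg (fun h' => h ⟨h'.2.1, h'.1, h'.2.2.symm⟩), neg_zero]

/-- The derivative of an entire function in a fixed direction, by Cauchy's formula. -/
lemma Differentiable.fderiv_apply_eq_circleIntegral {E : Type*} [NormedAddCommGroup E]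
    [NormedSpace ℂ E] {f : E → ℂ} (hf : Differentiable ℂ f) (z v : E) :
    fderiv ℂ f z v = (2 * Real.pi * I : ℂ)⁻¹ * ∫ θ in (0 : ℝ)..2 * Real.pi,
      (_root_.deriv (circleMap 0 1) θ * (circleMap 0 1 θ ^ 2)⁻¹) • f (z + circleMap 0 1 θ • v) := by
  have hg : Differentiable ℂ fun t : ℂ => f (z + t • v) := by fun_prop
  have h := cderiv_eq_deriv (r := 1) (z := 0) isOpen_univ hg.differentiableOn one_pos
    (Set.subset_univ _)
  have h2 : HasDerivAt (fun t : ℂ => f (z + t • v)) (fderiv ℂ f z v) 0 := by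
    have h3 : HasFDerivAt f (fderiv ℂ f z) (z + (0 : ℂ) • v) := by
      simpa using (hf z).hasFDerivAt
    have h4 : HasDerivAt (fun t : ℂ => z + t • v) v 0 := by
      simpa using ((hasDerivAt_id (0 : ℂ)).smul_const v).const_add z
    exact h3.comp_hasDerivAt 0 h4
  rw [← h2.deriv, ← h, cderiv, circleIntegral, smul_eq_mul]
  simp only [sub_zero, smul_smul]

lemma Differentiable.continuous_fderiv_apply {E : Type*} [NormedAddCommGroup E]
    [NormedSpace ℂ E] {f : E → ℂ} (hf : Differentiable ℂ f) (v : E) :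
    Continuous fun z => fderiv ℂ f z v := by
  simp only [hf.fderiv_apply_eq_circleIntegral _ v]
  refine continuous_const.mul ?_
  apply intervalIntegral.continuous_parametric_intervalIntegral_of_continuous'
  have hfc := hf.continuous
  have h0 : ∀ θ : ℝ, circleMap 0 1 θ ^ 2 ≠ 0 := fun θ =>
    pow_ne_zero _ (circleMap_ne_center one_ne_zero)
  have hc : Continuous (circleMap 0 1) := continuous_circleMap 0 1
  simp only [deriv_circleMap, Function.uncurry_def]
  fun_prop (disch := intros; exact h0 _)

/-- Directional derivatives of an entire function are entire. -/
lemma Differentiable.differentiable_fderiv_apply {E : Type*} [NormedAddCommGroup E]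
    [NormedSpace ℂ E] [FiniteDimensional ℂ E] {f : E → ℂ} (hf : Differentiable ℂ f) (v : E) :
    Differentiable ℂ fun z => fderiv ℂ f z v := by
  have hfc := hf.continuous
  have hf' : Continuous (fderiv ℂ f) := continuous_clm_apply.2 hf.continuous_fderiv_apply
  have h0 : ∀ θ : ℝ, circleMap 0 1 θ ^ 2 ≠ 0 := fun θ =>
    pow_ne_zero _ (circleMap_ne_center one_ne_zero)
  have hc : Continuous (circleMap 0 1) := continuous_circleMap 0 1
  have : ProperSpace E := FiniteDimensional.proper ℂ E
  set c : ℝ → ℂ := fun θ => _root_.deriv (circleMap 0 1) θ * (circleMap 0 1 θ ^ 2)⁻¹ with hcdef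
  have hcc : Continuous c := by
    simp only [hcdef, deriv_circleMap]
    fun_prop (disch := intros; exact h0 _)
  simp only [hf.fderiv_apply_eq_circleIntegral _ v]
  refine (differentiable_const _).mul (fun z₀ => ?_)
  have hF' : Continuous fun p : E × ℝ => c p.2 • fderiv ℂ f (p.1 + circleMap 0 1 p.2 • v) := by
    fun_prop
  have hF : ∀ z, Continuous fun θ => c θ • f (z + circleMap 0 1 θ • v) := fun z => by fun_prop
  obtain ⟨M, hM⟩ := ((isCompact_closedBall z₀ 1).prod
    (isCompact_uIcc (a := (0 : ℝ)) (b := 2 * Real.pi))).exists_bound_of_continuousOn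
    hF'.continuousOn
  refine (intervalIntegral.hasFDerivAt_integral_of_dominated_of_fderiv_le (𝕜 := ℂ)
    (F' := fun z θ => c θ • fderiv ℂ f (z + circleMap 0 1 θ • v)) (bound := fun _ => M)
    (Metric.ball_mem_nhds z₀ one_pos) ?_ ?_ ?_ ?_ ?_ ?_).differentiableAt
  · exact Filter.Eventually.of_forall fun z => (hF z).aestronglyMeasurable
  · exact (hF z₀).intervalIntegrable _ _
  · exact (by fun_prop : Continuous _).aestronglyMeasurable
  · refine Filter.Eventually.of_forall fun θ hθ z hz => hM (z, θ) ⟨?_, ?_⟩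
    · exact Metric.ball_subset_closedBall hz
    · exact Set.uIoc_subset_uIcc hθ
  · exact intervalIntegrable_const
  · refine Filter.Eventually.of_forall fun θ _ z _ => ?_
    exact ((hasFDerivAt_comp_add_right _).2 (hf _).hasFDerivAt).const_smul (c θ)

/-- Entire functions on a finite-dimensional space are smooth. -/
lemma Differentiable.contDiff_nat {E : Type*} [NormedAddCommGroup E]
    [NormedSpace ℂ E] [FiniteDimensional ℂ E] (k : ℕ) {f : E → ℂ} (hf : Differentiable ℂ f) :
    ContDiff ℂ k f := by
  induction k generalizing f with
  | zero => exact contDiff_zero.2 hf.continuous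
  | succ k ih =>
    push_cast
    exact contDiff_succ_iff_fderiv_apply.2
      ⟨hf, by simp, fun v => ih (hf.differentiable_fderiv_apply v)⟩

lemma differentiable_pdz {n : ℕ} (j : Fin n) {f : Cn n → ℂ} (hf : Differentiable ℂ f) :
    Differentiable ℂ (pdz j f) := hf.differentiable_fderiv_apply _

/-- Partial derivatives of an entire function commute. -/
lemma pdz_comm {n : ℕ} (j l : Fin n) {f : Cn n → ℂ} (hf : Differentiable ℂ f) :
    pdz j (pdz l f) = pdz l (pdz j f) := by
  funext z
  have hf2 : ContDiff ℂ 2 f := hf.contDiff_nat 2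
  have hd : DifferentiableAt ℂ (fderiv ℂ f) z :=
    (hf2.fderiv_right (m := 1) (by norm_num)).differentiable (by norm_num) z
  have hs : IsSymmSndFDerivAt ℂ f z := hf2.contDiffAt.isSymmSndFDerivAt (by simp)
  have key : ∀ v w : Cn n, fderiv ℂ (fun y => fderiv ℂ f y v) z w = fderiv ℂ (fderiv ℂ f) z w v := by
    intro v w
    rw [fderiv_clm_apply hd (differentiableAt_const v)]
    simp
  unfold pdz
  rw [key, key]
  exact hs _ _

lemma pdz_add {n : ℕ} (j : Fin n) {f g : Cn n → ℂ} (hf : Differentiable ℂ f)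
    (hg : Differentiable ℂ g) (z : Cn n) :
    pdz j (fun z => f z + g z) z = pdz j f z + pdz j g z := by
  simp [pdz, fderiv_fun_add (hf z) (hg z)]

lemma pdz_zero {n : ℕ} (j : Fin n) : pdz j (0 : Cn n → ℂ) = 0 := by
  funext z; simp [pdz]

lemma pdz_sum_const_mul {n : ℕ} {ι : Type*} (j : Fin n) (s : Finset ι) (c : ι → ℂ)
    {f : ι → Cn n → ℂ} (hf : ∀ i, Differentiable ℂ (f i)) (z : Cn n) :
    pdz j (fun z => ∑ i ∈ s, c i * f i z) z = ∑ i ∈ s, c i * pdz j (f i) z := by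
  unfold pdz
  rw [fderiv_fun_sum fun i _ => ((hf i).const_mul (c i)) z]
  simp [fderiv_const_mul (hf _ z)]

/-- `∂ ∘ ∂ = 0` on forms with entire coefficients. -/
lemma dOp_dOp {n : ℕ} {u : FormC n} (hu : ∀ J, Differentiable ℂ (u J)) : dOp (dOp u) = 0 := by
  funext L z
  have key : dOp (dOp u) L z = ∑ j, ∑ l, (if j ∈ L ∧ l ∈ L ∧ l ≠ j then
      sgn j (L.erase j) * sgn l ((L.erase j).erase l) *
        pdz j (pdz l (u ((L.erase j).erase l))) z else 0) := by
    rw [← Finset.sum_filter_add_sum_filter_not univ (fun j => j ∈ L)]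
    rw [Finset.sum_eq_zero (s := univ.filter fun j => ¬ j ∈ L), add_zero]
    · refine Finset.sum_congr (by ext; simp) fun j hj => ?_
      have hj' : j ∈ L := by simpa using hj
      rw [← Finset.sum_filter]
      unfold dOp
      rw [pdz_sum_const_mul j (L.erase j) (fun l => sgn l ((L.erase j).erase l))
        (fun l => differentiable_pdz l (hu _)), Finset.mul_sum]
      refine Finset.sum_congr (by ext; simp [hj', and_comm]) fun l _ => by ring
    · intro j hj
      have : j ∉ L := by simpa using hj
      simp [this]
  rw [key]
  refine sum_sum_eq_zero_of_antisymm _ fun j l => ?_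
  by_cases h : j ∈ L ∧ l ∈ L ∧ l ≠ j
  · rw [if_pos h, if_pos ⟨h.2.1, h.1, h.2.2.symm⟩, pdz_comm j l (hu _),
      Finset.erase_right_comm (a := l) (b := j)]
    have h1 : L.erase j = insert l ((L.erase j).erase l) :=
      (Finset.insert_erase (by simp [h])).symm
    have h2 : L.erase l = insert j ((L.erase j).erase l) := by
      rw [Finset.erase_right_comm, Finset.insert_erase (by simp [h, h.2.2.symm])]
    have h3 := sgn_mul_sgn_insert (j := j) (l := l) (K := (L.erase j).erase l)
      (by simp) (by simp) h.2.2.symm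
    rw [← h1, ← h2] at h3
    linear_combination (pdz l (pdz j (u ((L.erase j).erase l))) z) * h3
  · rw [if_neg h, if_neg (fun h' => h ⟨h'.2.1, h'.1, h'.2.2.symm⟩), neg_zero]

lemma fWt_nonneg {n : ℕ} (z : Cn n) : 0 ≤ fWt z := (Real.exp_pos _).le

lemma fWt_pos {n : ℕ} (z : Cn n) : 0 < fWt z := Real.exp_pos _

lemma hasFDerivAt_fWt {n : ℕ} (z : Cn n) :
    HasFDerivAt (𝕜 := ℝ) fWt
      (fWt z • -∑ j, (2 * (z j).re) • (reCLM.comp (ContinuousLinearMap.proj (R := ℝ) j)) +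
        fWt z • -∑ j, (2 * (z j).im) • (imCLM.comp (ContinuousLinearMap.proj (R := ℝ) j))) z := by
  have hre : ∀ j, HasFDerivAt (fun z : Cn n => (z j).re ^ 2)
      ((2 * (z j).re) • (reCLM.comp (ContinuousLinearMap.proj (R := ℝ) j))) z := fun j => by
    have h := (reCLM.comp (ContinuousLinearMap.proj (R := ℝ) (φ := fun _ : Fin n => ℂ) j)
      |>.hasFDerivAt (x := z)).pow 2
    simpa using h
  have him : ∀ j, HasFDerivAt (fun z : Cn n => (z j).im ^ 2)
      ((2 * (z j).im) • (imCLM.comp (ContinuousLinearMap.proj (R := ℝ) j))) z := fun j => by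
    have h := (imCLM.comp (ContinuousLinearMap.proj (R := ℝ) (φ := fun _ : Fin n => ℂ) j)
      |>.hasFDerivAt (x := z)).pow 2
    simpa using h
  have h := ((HasFDerivAt.fun_sum fun j (_ : j ∈ univ) => hre j).add
    (HasFDerivAt.fun_sum fun j (_ : j ∈ univ) => him j)).neg.exp
  have hw : (fWt : Cn n → ℝ) = fun z => Real.exp (-((∑ j, (z j).re ^ 2) + ∑ j, (z j).im ^ 2)) := by
    funext y
    simp only [fWt, ← Finset.sum_add_distrib, Complex.sq_norm, Complex.normSq_apply]
    simp only [pow_two]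
  rw [hw]
  rw [← smul_add, ← neg_add]
  exact h

lemma contDiff_fWt {n : ℕ} : ContDiff ℝ 1 (fWt : Cn n → ℝ) := by
  have : ∀ j : Fin n, ContDiff ℝ 1 fun z : Cn n => ‖z j‖ ^ 2 := fun j =>
    (contDiff_norm_sq ℝ).comp (contDiff_apply ℝ ℂ j)
  unfold fWt
  exact Real.contDiff_exp.comp (ContDiff.sum fun j _ => this j).neg

lemma continuous_fWt {n : ℕ} : Continuous (fWt : Cn n → ℝ) := contDiff_fWt.continuous

/-- The Wirtinger derivative `∂χ/∂z_j` of a real-valued function. -/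
def wirtinger {n : ℕ} (j : Fin n) (χ : Cn n → ℝ) (z : Cn n) : ℂ :=
  ((fderiv ℝ χ z (Pi.single j 1) : ℂ) - I * (fderiv ℝ χ z (Pi.single j I) : ℂ)) / 2

lemma wirtinger_mul_fWt {n : ℕ} (j : Fin n) {χ : Cn n → ℝ} (hχ : ContDiff ℝ 1 χ) (z : Cn n) :
    wirtinger j (fun z => χ z * fWt z) z =
      wirtinger j χ z * fWt z - (starRingEnd ℂ) (z j) * (χ z * fWt z) := by
  have h := ((hχ.differentiable one_ne_zero z).hasFDerivAt.mul (hasFDerivAt_fWt z)).fderiv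
  have h' : fderiv ℝ (fun z => χ z * fWt z) z = _ := h
  unfold wirtinger
  rw [h']
  simp [Pi.single_apply, apply_ite, Complex.ext_iff]
  constructor <;> ring

lemma continuous_wirtinger {n : ℕ} (j : Fin n) {χ : Cn n → ℝ} (hχ : ContDiff ℝ 1 χ) :
    Continuous (wirtinger j χ) := by
  have := hχ.continuous_fderiv one_ne_zero
  unfold wirtinger
  fun_prop

lemma hasCompactSupport_wirtinger {n : ℕ} (j : Fin n) {χ : Cn n → ℝ} (hc : HasCompactSupport χ) :
    HasCompactSupport (wirtinger j χ) := by
  refine (hc.fderiv ℝ).mono fun z hz => ?_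
  contrapose! hz
  have : fderiv ℝ χ z = 0 := by simpa using hz
  simp [wirtinger, this]

/-- `∫ (∂f/∂z_j) ḡ φ = -∫ f ḡ ∂φ/∂z_j` for entire `f`, `g` and a test function `φ`. -/
lemma integral_pdz_mul {n : ℕ} (j : Fin n) {f g : Cn n → ℂ} (hf : Differentiable ℂ f)
    (hg : Differentiable ℂ g) {φ : Cn n → ℝ} (hφ : ContDiff ℝ 1 φ) (hc : HasCompactSupport φ) :
    ∫ z, pdz j f z * (starRingEnd ℂ) (g z) * φ z =
      -∫ z, f z * (starRingEnd ℂ) (g z) * wirtinger j φ z := by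
  set Φ : Cn n → ℂ := fun z => (φ z : ℂ) with hΦ
  set F : Cn n → ℂ := fun z => f z * (starRingEnd ℂ) (g z) with hF
  have hfc := hf.continuous
  have hgc := hg.continuous
  have hφc := hφ.continuous
  have hφ'c := hφ.continuous_fderiv one_ne_zero
  have hpf : Continuous (fun z => fderiv ℂ f z) := continuous_clm_apply.2 hf.continuous_fderiv_apply
  have hpg : Continuous (fun z => fderiv ℂ g z) := continuous_clm_apply.2 hg.continuous_fderiv_apply
  have hΦd : ∀ z, HasFDerivAt Φ (ofRealCLM.comp (fderiv ℝ φ z)) z := fun z =>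
    ofRealCLM.hasFDerivAt.comp z (hφ.differentiable one_ne_zero z).hasFDerivAt
  have hFd : ∀ z, HasFDerivAt F
      (f z • (conjCLE.toContinuousLinearMap.comp ((fderiv ℂ g z).restrictScalars ℝ)) +
        (starRingEnd ℂ) (g z) • (fderiv ℂ f z).restrictScalars ℝ) z := fun z =>
    ((hf z).hasFDerivAt.restrictScalars ℝ).mul
      (conjCLE.hasFDerivAt.comp z ((hg z).hasFDerivAt.restrictScalars ℝ))
  have hΦv : ∀ v z, fderiv ℝ Φ z v = (fderiv ℝ φ z v : ℂ) := fun v z => by rw [(hΦd z).fderiv]; rfl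
  have hFv : ∀ v z, fderiv ℝ F z v =
      f z * (starRingEnd ℂ) (fderiv ℂ g z v) + (starRingEnd ℂ) (g z) * fderiv ℂ f z v := fun v z => by
    rw [(hFd z).fderiv]; rfl
  have hΦs : HasCompactSupport Φ := hc.comp_left (g := fun x : ℝ => (x : ℂ)) (by simp)
  have hΦ's : ∀ v, HasCompactSupport fun z => (fderiv ℝ φ z v : ℂ) := fun v =>
    (hc.fderiv ℝ).comp_left (g := fun L : Cn n →L[ℝ] ℝ => (L v : ℂ)) (by simp)
  have i1 : ∀ v, Integrable fun z => fderiv ℝ Φ z v * F z := fun v => by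
    simp only [hΦv, hF]
    exact (by fun_prop : Continuous _).integrable_of_hasCompactSupport (hΦ's v).mul_right
  have i2 : ∀ v, Integrable fun z => Φ z * fderiv ℝ F z v := fun v => by
    simp only [hFv]
    exact (by fun_prop : Continuous _).integrable_of_hasCompactSupport hΦs.mul_right
  have i3 : Integrable fun z => Φ z * F z :=
    (by fun_prop : Continuous _).integrable_of_hasCompactSupport hΦs.mul_right
  have ibp : ∀ v, ∫ z, Φ z * fderiv ℝ F z v = -∫ z, fderiv ℝ Φ z v * F z := fun v =>
    integral_mul_fderiv_eq_neg_fderiv_mul_of_integrable (i1 v) (i2 v) i3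
      (fun z _ => (hΦd z).differentiableAt) (fun z _ => (hFd z).differentiableAt)
  have hI : ∀ h : Cn n → ℂ, ∀ z, fderiv ℂ h z (Pi.single j I) =
      I * fderiv ℂ h z (Pi.single j 1) := fun h z => by
    rw [← smul_eq_mul, ← map_smul, ← Pi.single_smul', smul_eq_mul, mul_one]
  have e1 : ∀ z, pdz j f z * (starRingEnd ℂ) (g z) * φ z =
      (1 / 2) * (Φ z * fderiv ℝ F z (Pi.single j 1)) -
        (I / 2) * (Φ z * fderiv ℝ F z (Pi.single j I)) := fun z => by
    simp only [hFv, hI, pdz, hΦ, map_mul, conj_I]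
    linear_combination (1 / 2 * (φ z : ℂ) * (starRingEnd ℂ (g z) * fderiv ℂ f z (Pi.single j 1)
      - f z * (starRingEnd ℂ) (fderiv ℂ g z (Pi.single j 1)))) * I_mul_I
  have e2 : ∀ z, f z * (starRingEnd ℂ) (g z) * wirtinger j φ z =
      (1 / 2) * (fderiv ℝ Φ z (Pi.single j 1) * F z) -
        (I / 2) * (fderiv ℝ Φ z (Pi.single j I) * F z) := fun z => by
    simp only [hΦv, wirtinger, hF]
    ring
  simp only [e1, e2]
  rw [integral_sub ((i2 _).const_mul _) ((i2 _).const_mul _),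
    integral_sub ((i1 _).const_mul _) ((i1 _).const_mul _)]
  simp only [integral_const_mul, ibp]
  ring

/-- Integration by parts against the Fock weight, in the presence of a cutoff `χ`. -/
lemma integral_pdz_mul_cutoff {n : ℕ} (j : Fin n) {f g : Cn n → ℂ} (hf : Differentiable ℂ f)
    (hg : Differentiable ℂ g) {χ : Cn n → ℝ} (hχ : ContDiff ℝ 1 χ) (hc : HasCompactSupport χ) :
    ∫ z, pdz j f z * (starRingEnd ℂ) (g z) * fWt z * χ z =
      (∫ z, f z * (starRingEnd ℂ) (z j * g z) * fWt z * χ z) -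
        ∫ z, f z * (starRingEnd ℂ) (g z) * fWt z * wirtinger j χ z := by
  have hfc := hf.continuous
  have hgc := hg.continuous
  have hχc := hχ.continuous
  have hw := continuous_fWt (n := n)
  have hχ' := continuous_wirtinger j hχ
  have hs : HasCompactSupport fun z => (χ z : ℂ) :=
    hc.comp_left (g := fun x : ℝ => (x : ℂ)) (by simp)
  have h := integral_pdz_mul j hf hg (hχ.mul contDiff_fWt) (hc.mul_right (f' := fWt))
  rw [← integral_sub]
  · rw [← integral_neg] at h
    convert h using 1
    · refine integral_congr_ae (Eventually.of_forall fun z => ?_)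
      simp only [ofReal_mul]
      ring
    · refine integral_congr_ae (Eventually.of_forall fun z => ?_)
      simp only [wirtinger_mul_fWt j hχ, map_mul]
      ring
  · exact (by fun_prop : Continuous _).integrable_of_hasCompactSupport hs.mul_left
  · exact (by fun_prop : Continuous _).integrable_of_hasCompactSupport
      (hasCompactSupport_wirtinger j hc).mul_left

/-- A sequence of compactly supported cutoffs exhausting `ℂⁿ`, with uniformly bounded gradients
that tend to zero. -/
lemma exists_cutoff (n : ℕ) : ∃ χ : ℕ → Cn n → ℝ,
    (∀ m, ContDiff ℝ 1 (χ m)) ∧ (∀ m, HasCompactSupport (χ m)) ∧ (∀ m z, ‖χ m z‖ ≤ 1) ∧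
    (∀ z, Tendsto (fun m => χ m z) atTop (nhds 1)) ∧
    (∃ C, ∀ m z, ‖fderiv ℝ (χ m) z‖ ≤ C) ∧
    (∀ z, Tendsto (fun m => fderiv ℝ (χ m) z) atTop (nhds 0)) := by
  let b : ContDiffBump (0 : Cn n) := ⟨1, 2, one_pos, one_lt_two⟩
  have hb : ContDiff ℝ 1 b := b.contDiff
  let ε : ℕ → ℝ := fun m => 1 / ((m : ℝ) + 1)
  have hε0 : ∀ m, 0 < ε m := fun m => by positivity
  have hε1 : ∀ m, ε m ≤ 1 := fun m => by
    rw [div_le_one (by positivity)]; linarith [(Nat.cast_nonneg m : (0 : ℝ) ≤ m)]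
  have hεt : Tendsto ε atTop (nhds 0) := tendsto_one_div_add_atTop_nhds_zero_nat
  obtain ⟨C, hC⟩ := (b.hasCompactSupport.fderiv ℝ).exists_bound_of_continuous
    (hb.continuous_fderiv one_ne_zero)
  have hfd : ∀ m z, fderiv ℝ (fun z => b (ε m • z)) z = ε m • fderiv ℝ b (ε m • z) := fun m z => by
    rw [fderiv_comp_smul]
  have hn : ∀ m z, ‖fderiv ℝ (fun z => b (ε m • z)) z‖ ≤ ε m * C := fun m z => by
    rw [hfd, norm_smul, Real.norm_of_nonneg (hε0 m).le]
    exact mul_le_mul_of_nonneg_left (hC _) (hε0 m).le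
  have hC0 : 0 ≤ C := (norm_nonneg _).trans (hC 0)
  refine ⟨fun m z => b (ε m • z), fun m => by fun_prop, fun m => ?_, fun m z => ?_, fun z => ?_,
    ⟨C, fun m z => (hn m z).trans (mul_le_of_le_one_left hC0 (hε1 m))⟩, fun z => ?_⟩
  · exact b.hasCompactSupport.comp_smul (hε0 m).ne'
  · rw [Real.norm_of_nonneg b.nonneg]; exact b.le_one
  · have h1 : Tendsto (fun m => b (ε m • z)) atTop (nhds (b ((0 : ℝ) • z))) :=
      (b.continuous.tendsto _).comp (hεt.smul_const z)
    rwa [zero_smul, b.one_of_mem_closedBall (by simp [b.rIn_pos.le])] at h1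
  · refine squeeze_zero_norm (hn · z) ?_
    simpa using hεt.mul_const C

lemma norm_wirtinger_le {n : ℕ} (j : Fin n) (χ : Cn n → ℝ) (z : Cn n) :
    ‖wirtinger j χ z‖ ≤ ‖fderiv ℝ χ z‖ := by
  have h : ∀ c : ℂ, ‖c‖ = 1 → ‖((fderiv ℝ χ z (Pi.single j c) : ℝ) : ℂ)‖ ≤ ‖fderiv ℝ χ z‖ := by
    intro c hc
    rw [Complex.norm_real]
    refine ((fderiv ℝ χ z).le_opNorm _).trans ?_
    rw [Pi.norm_single, hc, mul_one]
  have h1 := h 1 (by simp)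
  have h2 := h I (by simp)
  rw [wirtinger, norm_div, Complex.norm_ofNat, div_le_iff₀ two_pos]
  refine (norm_sub_le _ _).trans ?_
  rw [norm_mul, norm_I, one_mul]
  linarith

/-- Integrating against uniformly bounded continuous multipliers commutes with pointwise limits. -/
lemma tendsto_integral_mul_of_bounded {n : ℕ} {G : Cn n → ℂ} (hG : Integrable G)
    {c : ℕ → Cn n → ℂ} {a : ℂ} (hc : ∀ m, Continuous (c m)) {C : ℝ} (hC : ∀ m z, ‖c m z‖ ≤ C)
    (hl : ∀ z, Tendsto (fun m => c m z) atTop (nhds a)) :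
    Tendsto (fun m => ∫ z, G z * c m z) atTop (nhds ((∫ z, G z) * a)) := by
  rw [← integral_mul_const]
  refine tendsto_integral_of_dominated_convergence (fun z => ‖G z‖ * C)
    (fun m => hG.aestronglyMeasurable.mul (hc m).aestronglyMeasurable) (hG.norm.mul_const C)
    (fun m => Eventually.of_forall fun z => ?_)
    (Eventually.of_forall fun z => (hl z).const_mul _)
  rw [norm_mul]
  exact mul_le_mul_of_nonneg_left (hC m z) (norm_nonneg _)

/-- The integrand of the Fock inner product is integrable. -/
lemma MemF.integrable_mul {n : ℕ} {f g : Cn n → ℂ} (hf : MemF f) (hg : MemF g) :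
    Integrable fun z => f z * (starRingEnd ℂ) (g z) * fWt z := by
  have hfc := hf.1.continuous
  have hgc := hg.1.continuous
  have hw := continuous_fWt (n := n)
  refine (hf.2.add hg.2).mono' (by fun_prop : Continuous _).aestronglyMeasurable
    (Eventually.of_forall fun z => ?_)
  rw [norm_mul, norm_mul, RCLike.norm_conj, Complex.norm_real, Real.norm_of_nonneg (fWt_nonneg z),
    Pi.add_apply, ← add_mul]
  refine mul_le_mul_of_nonneg_right ?_ (fWt_nonneg z)
  nlinarith [sq_nonneg (‖f z‖ - ‖g z‖), sq_nonneg ‖f z‖, sq_nonneg ‖g z‖]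

lemma MemF.zero {n : ℕ} : MemF (0 : Cn n → ℂ) := ⟨differentiable_const 0, by simp⟩

lemma MemA2.zero {n : ℕ} : MemA2 (0 : FormC n) := fun _ => MemF.zero

/-- Reindexing of a double sum over pairs `j ∈ L` by `K = L \ {j}`. -/
lemma sum_sum_mem_eq_sum_sum_compl {n : ℕ} (a : Finset (Fin n) → Fin n → Finset (Fin n) → ℂ) :
    ∑ L : Finset (Fin n), ∑ j ∈ L, a L j (L.erase j) =
      ∑ K : Finset (Fin n), ∑ j ∈ Kᶜ, a (insert j K) j K := by
  rw [Finset.sum_sigma', Finset.sum_sigma']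
  refine Finset.sum_bij' (fun x _ => ⟨x.1.erase x.2, x.2⟩) (fun x _ => ⟨insert x.2 x.1, x.2⟩)
    ?_ ?_ ?_ ?_ ?_
  · rintro ⟨L, j⟩ h; simp
  · rintro ⟨K, j⟩ h; simp
  · rintro ⟨L, j⟩ h
    have : j ∈ L := by simpa using h
    simp [this]
  · rintro ⟨K, j⟩ h
    have : j ∉ K := by simpa using h
    simp [this]
  · rintro ⟨L, j⟩ h
    have : j ∈ L := by simpa using h
    simp [this]

/-- The adjoint relation between `∂` and `∂*`, up to an error term, in the presence of a cutoff. -/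
lemma sum_integral_dOp_cutoff {n : ℕ} {u v : FormC n} (hu : ∀ J, Differentiable ℂ (u J))
    (hv : ∀ J, Differentiable ℂ (v J)) {χ : Cn n → ℝ} (hχ : ContDiff ℝ 1 χ)
    (hc : HasCompactSupport χ) :
    ∑ L, ∫ z, dOp u L z * (starRingEnd ℂ) (v L z) * fWt z * χ z =
      (∑ K, ∫ z, u K z * (starRingEnd ℂ) (dStarOp v K z) * fWt z * χ z) -
        ∑ K, ∑ j ∈ Kᶜ, sgn j K *
          ∫ z, u K z * (starRingEnd ℂ) (v (insert j K) z) * fWt z * wirtinger j χ z := by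
  have huc := fun J => (hu J).continuous
  have hvc := fun J => (hv J).continuous
  have hpc := fun j J => (differentiable_pdz j (hu J)).continuous
  have hχc := hχ.continuous
  have hw := continuous_fWt (n := n)
  have hs : HasCompactSupport fun z => (χ z : ℂ) :=
    hc.comp_left (g := fun x : ℝ => (x : ℂ)) (by simp)
  have h1 : ∀ L, ∫ z, dOp u L z * (starRingEnd ℂ) (v L z) * fWt z * χ z =
      ∑ j ∈ L, sgn j (L.erase j) *
        ∫ z, pdz j (u (L.erase j)) z * (starRingEnd ℂ) (v L z) * fWt z * χ z := fun L => by
    simp only [← integral_const_mul]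
    rw [← integral_finsetSum]
    · refine integral_congr_ae (Eventually.of_forall fun z => ?_)
      simp only [dOp, Finset.sum_mul]
      exact Finset.sum_congr rfl fun j _ => by ring
    · intro j _
      exact Integrable.const_mul
        ((by fun_prop : Continuous _).integrable_of_hasCompactSupport hs.mul_left) _
  have h2 : ∀ K, ∫ z, u K z * (starRingEnd ℂ) (dStarOp v K z) * fWt z * χ z =
      ∑ j ∈ Kᶜ, sgn j K *
        ∫ z, u K z * (starRingEnd ℂ) (z j * v (insert j K) z) * fWt z * χ z := fun K => by
    simp only [← integral_const_mul]
    rw [← integral_finsetSum]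
    · refine integral_congr_ae (Eventually.of_forall fun z => ?_)
      simp only [dStarOp, map_sum, Finset.mul_sum, Finset.sum_mul]
      exact Finset.sum_congr rfl fun j _ => by rw [map_mul, conj_sgn]; ring
    · intro j _
      exact Integrable.const_mul
        ((by fun_prop : Continuous _).integrable_of_hasCompactSupport hs.mul_left) _
  simp only [h1, h2]
  rw [sum_sum_mem_eq_sum_sum_compl fun L j K => sgn j K *
        ∫ z, pdz j (u K) z * (starRingEnd ℂ) (v L z) * fWt z * χ z]
  simp only [← Finset.sum_sub_distrib, integral_pdz_mul_cutoff _ (hu _) (hv _) hχ hc, mul_sub]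

/-- `(∂u, v) = (u, ∂*v)` for `u ∈ dom ∂` and `v ∈ dom ∂*`. -/
lemma formInner_dOp {n : ℕ} {u v : FormC n} (hu : domD u) (hv : domDs v) :
    formInner (dOp u) v = formInner u (dStarOp v) := by
  obtain ⟨χ, hχ, hc, hb, hl, ⟨C, hC⟩, hl'⟩ := exists_cutoff n
  have hχc : ∀ m, Continuous fun z => (χ m z : ℂ) := fun m =>
    continuous_ofReal.comp (hχ m).continuous
  have hχb : ∀ m z, ‖(χ m z : ℂ)‖ ≤ 1 := fun m z => by rw [Complex.norm_real]; exact hb m z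
  have hχl : ∀ z, Tendsto (fun m => (χ m z : ℂ)) atTop (nhds 1) := fun z => by
    exact_mod_cast (continuous_ofReal.tendsto 1).comp (hl z)
  have t1 : Tendsto (fun m => ∑ L, ∫ z, dOp u L z * (starRingEnd ℂ) (v L z) * fWt z * χ m z) atTop
      (nhds (formInner (dOp u) v)) := by
    refine tendsto_finsetSum _ fun L _ => ?_
    simpa [fInner] using tendsto_integral_mul_of_bounded ((hu.2 L).integrable_mul (hv.1 L)) hχc hχb hχl
  have t2 : Tendsto (fun m => ∑ K, ∫ z, u K z * (starRingEnd ℂ) (dStarOp v K z) * fWt z * χ m z)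
      atTop (nhds (formInner u (dStarOp v))) := by
    refine tendsto_finsetSum _ fun L _ => ?_
    simpa [fInner] using tendsto_integral_mul_of_bounded ((hu.1 L).integrable_mul (hv.2 L)) hχc hχb hχl
  have t3 : Tendsto (fun m => ∑ K, ∑ j ∈ Kᶜ, sgn j K *
      ∫ z, u K z * (starRingEnd ℂ) (v (insert j K) z) * fWt z * wirtinger j (χ m) z) atTop
      (nhds (∑ K : Finset (Fin n), ∑ j ∈ Kᶜ, sgn j K * 0)) := by
    refine tendsto_finsetSum _ fun K _ => tendsto_finsetSum _ fun j _ => Tendsto.const_mul _ ?_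
    have h := tendsto_integral_mul_of_bounded (a := 0)
      ((hu.1 K).integrable_mul (hv.1 (insert j K)))
      (fun m => continuous_wirtinger j (hχ m))
      (fun m z => (norm_wirtinger_le j (χ m) z).trans (hC m z))
      (fun z => squeeze_zero_norm (fun m => norm_wirtinger_le j (χ m) z) (by simpa using (hl' z).norm))
    simpa using h
  have t4 := t2.sub t3
  simp only [mul_zero, Finset.sum_const_zero, sub_zero] at t4
  refine tendsto_nhds_unique t1 (t4.congr fun m => ?_)
  exact (sum_integral_dOp_cutoff (fun J => (hu.1 J).1) (fun J => (hv.1 J).1) (hχ m) (hc m)).symm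

lemma formInner_conj {n : ℕ} (u v : FormC n) :
    (starRingEnd ℂ) (formInner u v) = formInner v u := by
  simp only [formInner, fInner, map_sum, ← integral_conj, map_mul, conj_conj, conj_ofReal]
  refine Finset.sum_congr rfl fun J _ => integral_congr_ae (Eventually.of_forall fun z => ?_)
  simp only []
  ring

lemma formInner_add_left {n : ℕ} {u v w : FormC n} (hu : MemA2 u) (hv : MemA2 v) (hw : MemA2 w) :
    formInner (fun J z => u J z + v J z) w = formInner u w + formInner v w := by
  simp only [formInner, fInner, ← Finset.sum_add_distrib, add_mul]
  exact Finset.sum_congr rfl fun J _ =>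
    integral_add ((hu J).integrable_mul (hw J)) ((hv J).integrable_mul (hw J))

/-- The Fock inner product of forms is definite. -/
lemma eq_zero_of_formInner_self {n : ℕ} {u : FormC n} (hu : MemA2 u) (h : formInner u u = 0) :
    u = 0 := by
  have h1 : formInner u u = ((∑ J, ∫ z, ‖u J z‖ ^ 2 * fWt z : ℝ) : ℂ) := by
    simp only [formInner, fInner, ofReal_sum, ← integral_complex_ofReal, mul_conj]
    refine Finset.sum_congr rfl fun J _ => integral_congr_ae (Eventually.of_forall fun z => ?_)
    simp [normSq_eq_norm_sq]
  rw [h1, ofReal_eq_zero] at h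
  have hnn : ∀ J z, 0 ≤ ‖u J z‖ ^ 2 * fWt z := fun J z => mul_nonneg (sq_nonneg _) (fWt_nonneg z)
  have h2 := (Finset.sum_eq_zero_iff_of_nonneg fun J _ => integral_nonneg (hnn J)).1 h
  funext J z
  have hc := (hu J).1.continuous
  have hw := continuous_fWt (n := n)
  have h3 := (integral_eq_zero_iff_of_nonneg (hnn J) (hu J).2).1 (h2 J (mem_univ J))
  have h4 := (Continuous.ae_eq_iff_eq volume (by fun_prop) continuous_zero).1 h3
  simpa [(fWt_pos z).ne'] using congrFun h4 z

lemma dOp_zero {n : ℕ} : dOp (0 : FormC n) = 0 := by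
  funext L z; simp [dOp, pdz_zero]

lemma dStarOp_zero {n : ℕ} : dStarOp (0 : FormC n) = 0 := by
  funext K z; simp [dStarOp]

lemma dOp_add {n : ℕ} {u v : FormC n} (hu : ∀ J, Differentiable ℂ (u J))
    (hv : ∀ J, Differentiable ℂ (v J)) :
    dOp (fun J z => u J z + v J z) = fun J z => dOp u J z + dOp v J z := by
  funext L z
  simp only [dOp, ← Finset.sum_add_distrib, pdz_add _ (hu _) (hv _), mul_add]

lemma dStarOp_add {n : ℕ} (u v : FormC n) :
    dStarOp (fun J z => u J z + v J z) = fun J z => dStarOp u J z + dStarOp v J z := by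
  funext L z
  simp only [dStarOp, ← Finset.sum_add_distrib, mul_add]

lemma IsDeg.dOp {n p : ℕ} {u : FormC n} (hu : IsDeg p u) : IsDeg (p + 1) (dOp u) := by
  intro L hL
  funext z
  refine Finset.sum_eq_zero fun j hj => ?_
  rw [hu (L.erase j), pdz_zero, Pi.zero_apply, mul_zero]
  intro h
  have := Finset.card_erase_add_one hj
  omega

lemma IsDeg.dStarOp_apply {n p : ℕ} {u : FormC n} (hu : IsDeg p u) {K : Finset (Fin n)}
    (hK : K.card + 1 ≠ p) : dStarOp u K = 0 := by
  funext z
  refine Finset.sum_eq_zero fun j hj => ?_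
  rw [hu (insert j K), Pi.zero_apply, mul_zero, mul_zero]
  rwa [Finset.card_insert_of_notMem (Finset.mem_compl.1 hj)]

lemma IsDeg.dStarOp {n p : ℕ} {u : FormC n} (hu : IsDeg p u) : IsDeg (p - 1) (dStarOp u) :=
  fun _ hK => hu.dStarOp_apply (by omega)

lemma IsDeg.dOp_dStarOp {n p : ℕ} {u : FormC n} (hu : IsDeg p u) :
    IsDeg p (_root_.dOp (_root_.dStarOp u)) := by
  intro L hL
  funext z
  refine Finset.sum_eq_zero fun j hj => ?_
  rw [hu.dStarOp_apply (by rwa [Finset.card_erase_add_one hj]), pdz_zero, Pi.zero_apply, mul_zero]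

lemma dOp_boxOp {n : ℕ} {w : FormC n} (hw : domBox w) :
    dOp (boxOp w) = dOp (dStarOp (dOp w)) := by
  unfold boxOp
  rw [dOp_add (fun J => (hw.2.2.1.2 J).1) (fun J => (hw.2.2.2.2 J).1),
    dOp_dOp fun J => (hw.2.1.2 J).1]
  simp

lemma dStarOp_boxOp {n : ℕ} (w : FormC n) :
    dStarOp (boxOp w) = dStarOp (dOp (dStarOp w)) := by
  unfold boxOp
  rw [dStarOp_add, dStarOp_dStarOp]
  simp

/-- `□̃ ∂w = ∂ □̃ w`. -/
lemma boxOp_dOp {n : ℕ} {w : FormC n} (hw : domBox w) : boxOp (dOp w) = dOp (boxOp w) := by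
  rw [dOp_boxOp hw]
  unfold boxOp
  rw [dOp_dOp fun J => (hw.1.1 J).1, dStarOp_zero]
  simp

/-- `□̃ ∂*w = ∂* □̃ w`. -/
lemma boxOp_dStarOp {n : ℕ} (w : FormC n) : boxOp (dStarOp w) = dStarOp (boxOp w) := by
  rw [dStarOp_boxOp]
  unfold boxOp
  rw [dStarOp_dStarOp, dOp_zero]
  simp

lemma domBox.dOp {n : ℕ} {w : FormC n} (hw : domBox w) (h : MemA2 (dOp (boxOp w))) :
    domBox (dOp w) := by
  have hdd := dOp_dOp fun J => (hw.1.1 J).1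
  refine ⟨⟨hw.1.2, ?_⟩, hw.2.2.1, ?_, hw.2.2.1.2, ?_⟩
  · rw [hdd]; exact MemA2.zero
  · rw [hdd]; exact ⟨MemA2.zero, by rw [dStarOp_zero]; exact MemA2.zero⟩
  · rwa [← dOp_boxOp hw]

lemma domBox.dStarOp {n : ℕ} {w : FormC n} (hw : domBox w) (h : MemA2 (dStarOp (boxOp w))) :
    domBox (dStarOp w) := by
  have hdd := dStarOp_dStarOp w
  refine ⟨hw.2.2.2, ⟨hw.2.1.2, ?_⟩, ⟨hw.2.2.2.2, ?_⟩, ?_⟩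
  · rw [hdd]; exact MemA2.zero
  · rwa [← dStarOp_boxOp]
  · rw [hdd]; exact ⟨MemA2.zero, by rw [dOp_zero]; exact MemA2.zero⟩

/-- If `□̃w` is orthogonal to `∂∂*w`, then `∂*w = 0`. -/
lemma dStarOp_eq_zero_of_formInner_boxOp {n : ℕ} {w : FormC n} (hw : domBox w)
    (h : formInner (boxOp w) (dOp (dStarOp w)) = 0) : dStarOp w = 0 := by
  have hdd := dOp_dOp fun J => (hw.2.1.2 J).1
  have hg : MemA2 (dOp (dStarOp w)) := hw.2.2.2.2
  have h0 : formInner (0 : FormC n) (dOp w) = 0 := by simp [formInner, fInner]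
  have h1 : formInner (dOp (dStarOp w)) (dStarOp (dOp w)) = 0 := by
    rw [← formInner_dOp ⟨hg, by rw [hdd]; exact MemA2.zero⟩ hw.2.2.1, hdd, h0]
  have h2 : dOp (dStarOp w) = 0 := by
    refine eq_zero_of_formInner_self hg ?_
    unfold boxOp at h
    rw [formInner_add_left hw.2.2.1.2 hg hg, ← formInner_conj, h1] at h
    simpa using h
  refine eq_zero_of_formInner_self hw.2.1.2 ?_
  rw [← formInner_dOp hw.2.2.2 hw.2.1, h2]
  simp [formInner, fInner]

/-- Commutation relations for `Ñ`: `Ñ_{p+1} ∂ = ∂ Ñ_p` on `dom ∂`,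
`Ñ_{p-1} ∂* = ∂* Ñ_p` on `dom ∂*`, and `∂* Ñ_p` vanishes on `(ker ∂)^⊥`. -/
theorem stmt13 {n p : ℕ} (hpn : p ≤ n)
    (Nm N0 N1 : FormC n → FormC n)
    (hNm : IsInvBox (p - 1) Nm) (hN0 : IsInvBox p N0) (hN1 : IsInvBox (p + 1) N1) :
    (∀ u : FormC n, IsDeg p u → domD u → N1 (dOp u) = dOp (N0 u)) ∧
    (∀ u : FormC n, IsDeg p u → domDs u → Nm (dStarOp u) = dStarOp (N0 u)) ∧
    (∀ k : FormC n, IsDeg p k → MemA2 k →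
      (∀ v : FormC n, IsDeg p v → MemA2 v → dOp v = 0 → formInner k v = 0) →
      dStarOp (N0 k) = 0) := by
  refine ⟨fun u hu hud => ?_, fun u hu hud => ?_, fun k hk hkA hort => ?_⟩
  · obtain ⟨⟨hdeg, hdom, hbox⟩, -⟩ := hN0 u hu hud.1
    exact (hN1 _ hu.dOp hud.2).2 _ hdeg.dOp (hdom.dOp (by rw [hbox]; exact hud.2))
      (by rw [boxOp_dOp hdom, hbox])
  · obtain ⟨⟨hdeg, hdom, hbox⟩, -⟩ := hN0 u hu hud.1
    exact (hNm _ hu.dStarOp hud.2).2 _ hdeg.dStarOp (hdom.dStarOp (by rw [hbox]; exact hud.2))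
      (by rw [boxOp_dStarOp, hbox])
  · obtain ⟨⟨hdeg, hdom, hbox⟩, -⟩ := hN0 k hk hkA
    refine dStarOp_eq_zero_of_formInner_boxOp hdom ?_
    rw [hbox]
    refine hort _ hdeg.dOp_dStarOp hdom.2.2.2.2 (dOp_dOp fun J => (hdom.2.1.2 J).1)
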